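/- arXiv:1909.12180 — 2 statements merged into one kernel-verified Lean document; each statement's English description precedes it below -/
import Mathlib

section
/- Let x_0 ∈ X and R > 0, and set b = (Σ_{k=1}^{K_i} α_k·exp(−max{d(x_0,μ_k) − R, 0}²/(2σ_k²))) / (Σ_{l=1}^{K_o} β_l·exp(−(d(x_0,ν_l) + R)²/(2θ_l²))). Then for every class y and every x with d(x,x_0) ≤ R it holds that p̂(y|x) ≤ (1/M) · (1 + M·b/λ) / (1 + b/λ). -/
open scoped BigOperators

/-- The confidence `(q * P + (lam / M) * O) / (P + lam * O)` with `q ≤ 1` is bounded through any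
upper bound `A` of the in-density `P` and any positive lower bound `B` of the out-density `O`. -/
lemma calibrated_confidence_le {q P O A B lam M : ℝ} (hM : 1 ≤ M) (hlam : 0 < lam)
    (hq : q ≤ 1) (hP : 0 ≤ P) (hB : 0 < B) (hPA : P ≤ A) (hBO : B ≤ O) :
    (q * P + (lam / M) * O) / (P + lam * O) ≤
      (1 / M) * ((1 + M * (A / B) / lam) / (1 + A / B / lam)) := by
  have hM0 : 0 < M := by linarith
  have hA : 0 ≤ A := hP.trans hPA
  have hO : 0 < O := hB.trans_le hBO
  have hrhs : (1 / M) * ((1 + M * (A / B) / lam) / (1 + A / B / lam)) =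
      (A + (lam / M) * B) / (A + lam * B) := by
    field_simp
    ring
  have hcross : P * B ≤ A * O := mul_le_mul hPA hBO hB.le hA
  have hinv : 0 ≤ 1 - 1 / M := sub_nonneg.2 ((div_le_one hM0).2 hM)
  rw [hrhs, div_le_div_iff₀ (by positivity) (by positivity)]
  calc (q * P + lam / M * O) * (A + lam * B)
      ≤ (P + lam / M * O) * (A + lam * B) := by
        gcongr
        exact mul_le_of_le_one_left hP hq
    _ = (A + lam / M * B) * (P + lam * O) - lam * (1 - 1 / M) * (A * O - P * B) := by ring
    _ ≤ (A + lam / M * B) * (P + lam * O) :=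
        sub_le_self _ (mul_nonneg (mul_nonneg hlam.le hinv) (sub_nonneg.2 hcross))

/-- **Corollary 1 (ball-confidence certificate).** For any `x₀` and `R > 0`, the calibrated
confidence on the closed ball of radius `R` around `x₀` is bounded by
`(1/M)·(1 + M·b/λ)/(1 + b/λ)` where
`b = (Σ_k α_k·exp(−max{d(x₀,μ_k)−R,0}²/(2σ_k²))) / (Σ_l β_l·exp(−(d(x₀,ν_l)+R)²/(2θ_l²)))`. -/
theorem ball_confidence_certificate {X : Type*} [MetricSpace X] {Ki Ko M : ℕ}
    (hM : 1 < M) (hKi : 0 < Ki) (hKo : 0 < Ko)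
    (α : Fin Ki → ℝ) (μ : Fin Ki → X) (σ : Fin Ki → ℝ)
    (β : Fin Ko → ℝ) (ν : Fin Ko → X) (θ : Fin Ko → ℝ)
    (hα : ∀ k, 0 < α k) (hβ : ∀ l, 0 < β l)
    (hσ : ∀ k, 0 < σ k) (hθ : ∀ l, 0 < θ l)
    (lam : ℝ) (hlam : 0 < lam)
    (q : Fin M → X → ℝ) (hq : ∀ m w, 0 ≤ q m w ∧ q m w ≤ 1)
    (phat : Fin M → X → ℝ)
    (hphat : ∀ m w, phat m w =
      (q m w * (∑ k, α k * Real.exp (-(dist w (μ k) ^ 2) / (2 * σ k ^ 2))) +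
          (lam / M) * (∑ l, β l * Real.exp (-(dist w (ν l) ^ 2) / (2 * θ l ^ 2)))) /
        ((∑ k, α k * Real.exp (-(dist w (μ k) ^ 2) / (2 * σ k ^ 2))) +
          lam * (∑ l, β l * Real.exp (-(dist w (ν l) ^ 2) / (2 * θ l ^ 2)))))
    (x₀ : X) (R : ℝ) (hR : 0 < R)
    (b : ℝ)
    (hb : b = (∑ k, α k * Real.exp (-(max (dist x₀ (μ k) - R) 0 ^ 2) / (2 * σ k ^ 2))) /
      (∑ l, β l * Real.exp (-((dist x₀ (ν l) + R) ^ 2) / (2 * θ l ^ 2)))) :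
    ∀ (y : Fin M) (x : X), dist x x₀ ≤ R →
      phat y x ≤ (1 / M) * ((1 + M * b / lam) / (1 + b / lam)) := by
  intro y x hx
  have : Nonempty (Fin Ko) := ⟨⟨0, hKo⟩⟩
  rw [hphat, hb]
  refine calibrated_confidence_le (by exact_mod_cast hM.le) hlam (hq y x).2
    (Finset.sum_nonneg fun k _ => mul_nonneg (hα k).le (Real.exp_pos _).le)
    (Finset.sum_pos (fun l _ => mul_pos (hβ l) (Real.exp_pos _)) Finset.univ_nonempty)
    (Finset.sum_le_sum fun k _ => ?_) (Finset.sum_le_sum fun l _ => ?_)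
  · have hdist : max (dist x₀ (μ k) - R) 0 ≤ dist x (μ k) := by
      refine max_le ?_ dist_nonneg
      linarith [dist_triangle_left x₀ (μ k) x]
    have := (hα k).le
    gcongr
  · have hdist : dist x (ν l) ≤ dist x₀ (ν l) + R := by
      linarith [dist_triangle x x₀ (ν l)]
    have := (hβ l).le
    gcongr
end

section
/- Let M > 1, λ > 0, q ∈ [0,1], p_i ≥ 0, p_o > 0 and b ≥ 0 be real numbers. If p_i/p_o ≤ b, then (q·p_i + (λ/M)·p_o) / (p_i + λ·p_o) ≤ (1/M) · (1 + M·b/λ) / (1 + b/λ). -/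
/-- If `p_i/p_o ≤ b`, then the calibrated confidence is bounded by
`(1/M)·(1 + M·b/λ)/(1 + b/λ)`. -/
theorem calibrated_confidence_le_of_ratio_le (M lam q pi po b : ℝ) (hM : 1 < M)
    (hlam : 0 < lam) (hq0 : 0 ≤ q) (hq1 : q ≤ 1) (hpi : 0 ≤ pi) (hpo : 0 < po)
    (hb : 0 ≤ b) (hratio : pi / po ≤ b) :
    (q * pi + (lam / M) * po) / (pi + lam * po) ≤
      (1 / M) * ((1 + M * b / lam) / (1 + b / lam)) := by
  have hM0 : 0 < M := by linarith
  have hle : pi ≤ b * po := (div_le_iff₀ hpo).mp hratio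
  have hlhs : (q * pi + (lam / M) * po) / (pi + lam * po) =
      (M * q * pi + lam * po) / (M * (pi + lam * po)) := by
    field_simp
  have hrhs : (1 / M) * ((1 + M * b / lam) / (1 + b / lam)) =
      (lam + M * b) / (M * (lam + b)) := by
    field_simp
  rw [hlhs, hrhs, div_le_div_iff₀ (by positivity) (by positivity)]
  have hslack : 0 ≤ (M - 1) * lam * (b * po - pi) :=
    mul_nonneg (mul_nonneg (by linarith) hlam.le) (by linarith)
  have hq : 0 ≤ M * pi * (lam + b) * (1 - q) :=
    mul_nonneg (by positivity) (by linarith)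
  linear_combination M * hslack + M * hq
end
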